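/- Let γ > 0 and ρ ∈ ℝ with γ²ρ² < (1+γ)², set σ² = (1+γ)/(2γ), η = ρ/2, D = 1 + 2γ + γ² − γ²ρ², and let Δφ ∈ ℝ. Let Σ = [[σ², 0, η cos Δφ, η sin Δφ], [0, σ², −η sin Δφ, η cos Δφ], [η cos Δφ, −η sin Δφ, σ², 0], [η sin Δφ, η cos Δφ, 0, σ²]]. For z = (x₁, y₁, x₂, y₂) ∈ ℝ⁴ define F(z, Δφ) = (x₁ + x₂ cos Δφ + y₂ sin Δφ)² + (y₁ − x₂ sin Δφ + y₂ cos Δφ)² and S(z) = x₁² + y₁² + x₂² + y₂². Then Σ is positive definite and for every z ∈ ℝ⁴: (1/√((2π)⁴ det Σ)) · exp( −(1/2) zᵀ Σ⁻¹ z ) = (γ²/(π² D)) · exp( γ²ρ F(z, Δφ) / D ) · exp( − γ(1+γ+γρ) S(z) / D ). -/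

import Mathlib

open Matrix Real
open scoped Real

/-- The symmetric matrix with diagonal blocks `a • 1` and off-diagonal block `b` times the
matrix `!![c, s; -s, c]`. -/
def rotationBlockMatrix (a b c s : ℝ) : Matrix (Fin 4) (Fin 4) ℝ :=
  !![a, 0, b * c, b * s;
     0, a, -b * s, b * c;
     b * c, -b * s, a, 0;
     b * s, b * c, 0, a]

theorem dotProduct_rotationBlockMatrix_mulVec (a b c s : ℝ) (z : Fin 4 → ℝ) :
    z ⬝ᵥ rotationBlockMatrix a b c s *ᵥ z =
      a * (z 0 ^ 2 + z 1 ^ 2 + z 2 ^ 2 + z 3 ^ 2) +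
        2 * b * (z 0 * (z 2 * c + z 3 * s) + z 1 * (-z 2 * s + z 3 * c)) := by
  simp [rotationBlockMatrix, dotProduct, mulVec, Fin.sum_univ_four]
  ring

theorem det_rotationBlockMatrix (a b : ℝ) {c s : ℝ} (h : c ^ 2 + s ^ 2 = 1) :
    (rotationBlockMatrix a b c s).det = (a ^ 2 - b ^ 2) ^ 2 := by
  have key : (rotationBlockMatrix a b c s).det = (a ^ 2 - b ^ 2 * (c ^ 2 + s ^ 2)) ^ 2 := by
    simp [rotationBlockMatrix, det_succ_row_zero, Fin.sum_univ_succ, Fin.succAbove]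
    ring
  rw [key, h, mul_one]

theorem inv_rotationBlockMatrix {a b c s : ℝ} (h : c ^ 2 + s ^ 2 = 1)
    (hab : a ^ 2 - b ^ 2 ≠ 0) :
    (rotationBlockMatrix a b c s)⁻¹ =
      (a ^ 2 - b ^ 2)⁻¹ • rotationBlockMatrix a (-b) c s := by
  apply inv_eq_right_inv
  have hs : s ^ 2 = 1 - c ^ 2 := by linarith
  have key : rotationBlockMatrix a b c s * rotationBlockMatrix a (-b) c s =
      (a ^ 2 - b ^ 2) • (1 : Matrix (Fin 4) (Fin 4) ℝ) := by
    ext i j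
    fin_cases i <;> fin_cases j <;>
      simp [rotationBlockMatrix, mul_apply, Fin.sum_univ_four] <;>
      ring_nf <;> (try rw [hs]) <;> ring
  rw [Matrix.mul_smul, key, smul_smul, inv_mul_cancel₀ hab, one_smul]

theorem posDef_rotationBlockMatrix {a b c s : ℝ} (h : c ^ 2 + s ^ 2 = 1) (hab : |b| < a) :
    (rotationBlockMatrix a b c s).PosDef := by
  refine posDef_iff_dotProduct_mulVec.mpr ⟨?_, fun z hz => ?_⟩
  · ext i j
    fin_cases i <;> fin_cases j <;> simp [rotationBlockMatrix]
  rw [star_trivial, dotProduct_rotationBlockMatrix_mulVec]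
  obtain ⟨hb₁, hb₂⟩ := abs_lt.mp hab
  have hpos : 0 < z 0 ^ 2 + z 1 ^ 2 + z 2 ^ 2 + z 3 ^ 2 := by
    obtain ⟨i, hi⟩ := Function.ne_iff.mp hz
    have hi' : 0 < z i ^ 2 := by
      have : z i ≠ 0 := hi
      positivity
    have h0 := sq_nonneg (z 0)
    have h1 := sq_nonneg (z 1)
    have h2 := sq_nonneg (z 2)
    have h3 := sq_nonneg (z 3)
    fin_cases i <;> simp at hi' <;> linarith
  set u := z 2 * c + z 3 * s with hu
  set v := -z 2 * s + z 3 * c with hv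
  have huv : z 2 ^ 2 + z 3 ^ 2 = u ^ 2 + v ^ 2 := by
    rw [hu, hv]
    linear_combination (-(z 2 ^ 2 + z 3 ^ 2)) * h
  have hS : z 0 ^ 2 + z 1 ^ 2 + z 2 ^ 2 + z 3 ^ 2 =
      z 0 ^ 2 + z 1 ^ 2 + (u ^ 2 + v ^ 2) := by linarith
  rw [hS] at hpos ⊢
  have hplus : 0 ≤ (z 0 + u) ^ 2 + (z 1 + v) ^ 2 := by positivity
  have hminus : 0 ≤ (z 0 - u) ^ 2 + (z 1 - v) ^ 2 := by positivity
  rcases le_total 0 b with hb | hb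
  · nlinarith [mul_nonneg hb hplus, mul_pos (sub_pos.mpr hb₂) hpos]
  · nlinarith [mul_nonneg (neg_nonneg.mpr hb) hminus, mul_pos (neg_lt_iff_pos_add.mp hb₁) hpos]

/-- **Closed form of the 4-dimensional Gaussian density of the real representation.**
With `σ² = (1+γ)/(2γ)`, `η = ρ/2`, `D = 1 + 2γ + γ² - γ²ρ²`, the covariance matrix `Σ`
is positive definite and the zero-mean Gaussian density with covariance `Σ` equals
`(γ²/(π² D)) exp(γ²ρ F(z,Δφ)/D) exp(-γ(1+γ+γρ) S(z)/D)` where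
`F(z,Δφ) = (x₁ + x₂ cos Δφ + y₂ sin Δφ)² + (y₁ - x₂ sin Δφ + y₂ cos Δφ)²` and
`S(z) = x₁² + y₁² + x₂² + y₂²`. -/
theorem diff_mod_gaussian_density_closed_form
    (γ ρ : ℝ) (hγ : 0 < γ) (hρ : γ ^ 2 * ρ ^ 2 < (1 + γ) ^ 2)
    (σ2 η D : ℝ)
    (hσ2 : σ2 = (1 + γ) / (2 * γ)) (hη : η = ρ / 2)
    (hD : D = 1 + 2 * γ + γ ^ 2 - γ ^ 2 * ρ ^ 2)
    (Δφ : ℝ)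
    (Sig : Matrix (Fin 4) (Fin 4) ℝ)
    (hSig : Sig = !![σ2, 0, η * Real.cos Δφ, η * Real.sin Δφ;
                     0, σ2, -η * Real.sin Δφ, η * Real.cos Δφ;
                     η * Real.cos Δφ, -η * Real.sin Δφ, σ2, 0;
                     η * Real.sin Δφ, η * Real.cos Δφ, 0, σ2])
    (F : (Fin 4 → ℝ) → ℝ → ℝ)
    (hF : ∀ (z : Fin 4 → ℝ) (φ : ℝ),
      F z φ = (z 0 + z 2 * Real.cos φ + z 3 * Real.sin φ) ^ 2
        + (z 1 - z 2 * Real.sin φ + z 3 * Real.cos φ) ^ 2)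
    (S : (Fin 4 → ℝ) → ℝ)
    (hS : ∀ z : Fin 4 → ℝ, S z = z 0 ^ 2 + z 1 ^ 2 + z 2 ^ 2 + z 3 ^ 2) :
    Sig.PosDef ∧
    ∀ z : Fin 4 → ℝ,
      (1 / Real.sqrt ((2 * π) ^ 4 * Sig.det)) *
          Real.exp (-(1 / 2) * (z ⬝ᵥ Sig⁻¹.mulVec z)) =
        (γ ^ 2 / (π ^ 2 * D)) * Real.exp (γ ^ 2 * ρ * F z Δφ / D) *
          Real.exp (-(γ * (1 + γ + γ * ρ) * S z) / D) := by
  have hcs := Real.cos_sq_add_sin_sq Δφ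
  have hSig' : Sig = rotationBlockMatrix σ2 η (Real.cos Δφ) (Real.sin Δφ) := hSig
  have hDpos : 0 < D := by rw [hD]; linarith
  have hdiff : σ2 ^ 2 - η ^ 2 = D / (4 * γ ^ 2) := by
    rw [hσ2, hη, hD]
    field_simp
    ring
  have hdiff_pos : 0 < σ2 ^ 2 - η ^ 2 := by rw [hdiff]; positivity
  have hσ2_pos : 0 < σ2 := by rw [hσ2]; positivity
  refine ⟨hSig' ▸ posDef_rotationBlockMatrix hcs
    (abs_lt_of_sq_lt_sq (sub_pos.mp hdiff_pos) hσ2_pos.le), fun z => ?_⟩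
  have hsqrt : √((2 * π) ^ 4 * Sig.det) = π ^ 2 * D / γ ^ 2 := by
    rw [hSig', det_rotationBlockMatrix _ _ hcs, hdiff,
      show (2 * π) ^ 4 * (D / (4 * γ ^ 2)) ^ 2 = (π ^ 2 * D / γ ^ 2) ^ 2 by field_simp; ring]
    exact Real.sqrt_sq (by positivity)
  have hexp : -(1 / 2) * (z ⬝ᵥ Sig⁻¹.mulVec z) =
      γ ^ 2 * ρ * F z Δφ / D + -(γ * (1 + γ + γ * ρ) * S z) / D := by
    have hFS : F z Δφ = S z + 2 * (z 0 * (z 2 * Real.cos Δφ + z 3 * Real.sin Δφ) +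
        z 1 * (-z 2 * Real.sin Δφ + z 3 * Real.cos Δφ)) := by
      rw [hF, hS]
      linear_combination (z 2 ^ 2 + z 3 ^ 2) * hcs
    rw [hSig', inv_rotationBlockMatrix hcs hdiff_pos.ne', smul_mulVec, dotProduct_smul,
      dotProduct_rotationBlockMatrix_mulVec, ← hS, hdiff, hFS, hσ2, hη, smul_eq_mul]
    field_simp
    ring
  rw [hsqrt, hexp, Real.exp_add, one_div_div, ← mul_assoc]
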